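/- arXiv:2005.07130 — 2 statements merged into one kernel-verified Lean document; each statement's English description precedes it below -/
import Mathlib

section
/- Let N = (P, T, F, Υ, In) be a safe Petri net with transits, n ∈ ℕ, and N^MC the parallel-approach net with labeling λ : T^MC → T. For every finite firing sequence In^MC = M_0 [τ_1⟩ M_1 [τ_2⟩ … [τ_k⟩ M_k of N^MC, the label sequence λ(τ_1), …, λ(τ_k) is a firing sequence of N from In, and for every j ∈ {0,…,k} the restriction M_j ∩ P equals the j-th marking of that firing sequence of N. -/
/-- A safe Petri net with transits `N = (P, T, F, Υ, In)`.
The flow relation `F ⊆ (P × T) ∪ (T × P)` is split into its two parts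
`Fpt` (arcs from places to transitions) and `Ftp` (arcs from transitions to places).
The transit relation `Υ(t) ⊆ (pre(t) ∪ {►}) × post(t)` is encoded with `Option α`,
where `none` plays the role of the distinguished start symbol `►`. -/
structure PNwT (α β : Type*) [DecidableEq α] [DecidableEq β] where
  P : Finset α
  T : Finset β
  Fpt : Finset (α × β)
  Ftp : Finset (β × α)
  Init : Finset α
  transit : β → Finset (Option α × α)
  fpt_mem : ∀ a ∈ Fpt, a.1 ∈ P ∧ a.2 ∈ T
  ftp_mem : ∀ a ∈ Ftp, a.1 ∈ T ∧ a.2 ∈ P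
  init_sub : Init ⊆ P
  transit_pre : ∀ t ∈ T, ∀ x ∈ transit t, ∀ p : α, x.1 = some p → (p, t) ∈ Fpt
  transit_post : ∀ t ∈ T, ∀ x ∈ transit t, (t, x.2) ∈ Ftp

variable {α β : Type*} [DecidableEq α] [DecidableEq β]

/-- `pre(t) = {p ∈ P | (p,t) ∈ F}`. -/
def PNwT.pre (N : PNwT α β) (t : β) : Finset α := N.P.filter fun p => (p, t) ∈ N.Fpt

/-- `post(t) = {p ∈ P | (t,p) ∈ F}`. -/
def PNwT.post (N : PNwT α β) (t : β) : Finset α := N.P.filter fun p => (t, p) ∈ N.Ftp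

/-- Places of the parallel-approach net: original places `Sum.inl p`,
the fresh places `ι_i = Sum.inr (i, none)` and copies `[p]_i = Sum.inr (i, some p)`. -/
abbrev MCPlace (α : Type*) (n : ℕ) := α ⊕ (Fin n × Option α)

/-- Transitions of the parallel-approach net: a pair `t_c = (t, c)` of an original
transition `t` and a tuple `c` choosing for each subnet `i` either a transit of `t`
(`some (x, p)`) or the marker `⊥` (`none`). -/
abbrev MCTran (α β : Type*) (n : ℕ) := β × (Fin n → Option (Option α × α))

/-- The set of places `P^MC` of the parallel-approach net. -/
def MCPlaces (N : PNwT α β) (n : ℕ) : Finset (MCPlace α n) :=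
  N.P.image Sum.inl ∪
    ((Finset.univ : Finset (Fin n)) ×ˢ insert (none : Option α) (N.P.image some)).image Sum.inr

/-- The set of transitions `T^MC` of the parallel-approach net: for each `t ∈ T` and each
tuple `c ∈ (Υ(t) ∪ {⊥})^n` exactly one transition `(t, c)`. -/
def MCTrans (N : PNwT α β) (n : ℕ) : Finset (MCTran α β n) :=
  N.T.biUnion fun t =>
    (Fintype.piFinset fun _ : Fin n => insert none ((N.transit t).image some)).image
      fun c => (t, c)

/-- The labeling `λ : T^MC → T`. -/
def MClabel (τ : MCTran α β n) : β := τ.1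

/-- The place-to-transition part of `F^MC`. -/
def MCFpt (N : PNwT α β) (n : ℕ) : Set (MCPlace α n × MCTran α β n) :=
  { a | a.2 ∈ MCTrans N n ∧
      match a.1 with
      | Sum.inl p => (p, a.2.1) ∈ N.Fpt
      | Sum.inr (i, none) => ∃ q, a.2.2 i = some (none, q)
      | Sum.inr (i, some x) => ∃ q, a.2.2 i = some (some x, q) }

/-- The transition-to-place part of `F^MC`. -/
def MCFtp (N : PNwT α β) (n : ℕ) : Set (MCTran α β n × MCPlace α n) :=
  { a | a.1 ∈ MCTrans N n ∧
      match a.2 with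
      | Sum.inl q => (a.1.1, q) ∈ N.Ftp
      | Sum.inr (_, none) => False
      | Sum.inr (i, some q) => ∃ x, a.1.2 i = some (x, q) }

/-- The inhibitor arcs `I^MC`: if `c_i = ⊥` then `([p]_i, t_c) ∈ I^MC` for all `p ∈ pre(t)`. -/
def MCInh (N : PNwT α β) (n : ℕ) : Set (MCPlace α n × MCTran α β n) :=
  { a | a.2 ∈ MCTrans N n ∧
      match a.1 with
      | Sum.inr (i, some p) => a.2.2 i = none ∧ p ∈ N.pre a.2.1
      | _ => False }

/-- The initial marking `In^MC = In ∪ {ι_1,…,ι_n}`. -/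
def MCInit (N : PNwT α β) (n : ℕ) : Set (MCPlace α n) :=
  (Sum.inl '' (↑N.Init : Set α)) ∪ Set.range (fun i : Fin n => Sum.inr (i, none))

/-- The preset of a transition of the parallel-approach net. -/
def MCpre (N : PNwT α β) (n : ℕ) (τ : MCTran α β n) : Set (MCPlace α n) :=
  { pl | (pl, τ) ∈ MCFpt N n }

/-- The postset of a transition of the parallel-approach net. -/
def MCpost (N : PNwT α β) (n : ℕ) (τ : MCTran α β n) : Set (MCPlace α n) :=
  { pl | (τ, pl) ∈ MCFtp N n }

/-- Firing `M [τ⟩ M'` in the parallel-approach net (with inhibitor arcs):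
`τ` is a transition of `N^MC`, `pre(τ) ⊆ M`, no place connected to `τ` by an
inhibitor arc is in `M`, and `M' = (M \ pre(τ)) ∪ post(τ)`. -/
def MCfire (N : PNwT α β) (n : ℕ) (M : Set (MCPlace α n)) (τ : MCTran α β n)
    (M' : Set (MCPlace α n)) : Prop :=
  τ ∈ MCTrans N n ∧ MCpre N n τ ⊆ M ∧ (∀ pl, (pl, τ) ∈ MCInh N n → pl ∉ M) ∧
  M' = (M \ MCpre N n τ) ∪ MCpost N n τ

/-- Firing `M [t⟩ M'` in the original net (no inhibitor arcs). -/
def PNwT.fire (N : PNwT α β) (M : Set α) (t : β) (M' : Set α) : Prop :=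
  t ∈ N.T ∧ (↑(N.pre t) : Set α) ⊆ M ∧ M' = (M \ ↑(N.pre t)) ∪ ↑(N.post t)

/-- Reachable markings of the parallel-approach net from `In^MC`. -/
def MCreach (N : PNwT α β) (n : ℕ) : Set (Set (MCPlace α n)) :=
  { M | Relation.ReflTransGen (fun A B => ∃ τ, MCfire N n A τ B) (MCInit N n) M }

theorem fst_mem_of_mem_MCTrans {N : PNwT α β} {n : ℕ} {τ : MCTran α β n}
    (h : τ ∈ MCTrans N n) : τ.1 ∈ N.T := by
  simp only [MCTrans, Finset.mem_biUnion, Finset.mem_image] at h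
  obtain ⟨t, ht, c, -, rfl⟩ := h
  exact ht

theorem inl_mem_MCpre_iff {N : PNwT α β} {n : ℕ} {τ : MCTran α β n}
    (h : τ ∈ MCTrans N n) (p : α) : Sum.inl p ∈ MCpre N n τ ↔ p ∈ N.pre τ.1 := by
  simp only [MCpre, MCFpt, PNwT.pre, Set.mem_ofPred_eq, Finset.mem_filter, h, true_and]
  exact ⟨fun hp => ⟨(N.fpt_mem _ hp).1, hp⟩, And.right⟩

theorem inl_mem_MCpost_iff {N : PNwT α β} {n : ℕ} {τ : MCTran α β n}
    (h : τ ∈ MCTrans N n) (p : α) : Sum.inl p ∈ MCpost N n τ ↔ p ∈ N.post τ.1 := by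
  simp only [MCpost, MCFtp, PNwT.post, Set.mem_ofPred_eq, Finset.mem_filter, h, true_and]
  exact ⟨fun hp => ⟨(N.ftp_mem _ hp).2, hp⟩, And.right⟩

/-- A single firing of `N^MC` restricts to a firing of `N`. -/
theorem MCfire.fire {N : PNwT α β} {n : ℕ} {M M' : Set (MCPlace α n)} {τ : MCTran α β n}
    (h : MCfire N n M τ M') :
    N.fire { p : α | Sum.inl p ∈ M } (MClabel τ) { p : α | Sum.inl p ∈ M' } := by
  obtain ⟨hτ, hpre, -, rfl⟩ := h
  refine ⟨fst_mem_of_mem_MCTrans hτ, fun p hp => hpre ((inl_mem_MCpre_iff hτ p).2 hp), ?_⟩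
  ext p
  simp only [Set.mem_ofPred_eq, Set.mem_union, Set.mem_sdiff, Finset.mem_coe, MClabel,
    inl_mem_MCpre_iff hτ, inl_mem_MCpost_iff hτ]

/-- for every finite firing sequence
`In^MC = M_0 [τ_1⟩ M_1 [τ_2⟩ … [τ_k⟩ M_k` of `N^MC`, the label sequence
`λ(τ_1), …, λ(τ_k)` is a firing sequence of `N` from `In`, where the `j`-th marking of
that firing sequence of `N` is exactly the restriction `M_j ∩ P`. -/
theorem mcFiring_projects (N : PNwT α β) (n k : ℕ)
    (M : Fin (k + 1) → Set (MCPlace α n)) (τ : Fin k → MCTran α β n)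
    (h0 : M 0 = MCInit N n)
    (hstep : ∀ j : Fin k, MCfire N n (M j.castSucc) (τ j) (M j.succ)) :
    ({ p : α | Sum.inl p ∈ M 0 } = (↑N.Init : Set α)) ∧
    ∀ j : Fin k,
      N.fire { p : α | Sum.inl p ∈ M j.castSucc } (MClabel (τ j))
        { p : α | Sum.inl p ∈ M j.succ } := by
  refine ⟨?_, fun j => (hstep j).fire⟩
  ext p
  simp [h0, MCInit]
end

section
/- Let N = (P, T, F, Υ, In) be a safe Petri net with transits, n ∈ ℕ, and N^MC the parallel-approach net. Then each tracking subnet carries exactly one token: for every marking M reachable in N^MC from In^MC and every i ∈ {1,…,n}, exactly one place of the set {ι_i} ∪ {[p]_i | p ∈ P} belongs to M. -/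
variable {α β : Type*} [DecidableEq α] [DecidableEq β]

theorem mem_MCTrans_iff (N : PNwT α β) (n : ℕ) (τ : MCTran α β n) :
    τ ∈ MCTrans N n ↔
      τ.1 ∈ N.T ∧ ∀ i, τ.2 i = none ∨ ∃ a ∈ N.transit τ.1, τ.2 i = some a := by
  obtain ⟨t, c⟩ := τ
  simp only [MCTrans, Finset.mem_biUnion, Finset.mem_image, Fintype.mem_piFinset,
    Finset.mem_insert, Prod.mk.injEq]
  constructor
  · rintro ⟨t, ht, c, hc, rfl, rfl⟩
    exact ⟨ht, fun i => (hc i).imp_right fun ⟨a, ha, h⟩ => ⟨a, ha, h.symm⟩⟩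
  · rintro ⟨ht, hc⟩
    exact ⟨t, ht, c, fun i => (hc i).imp_right fun ⟨a, ha, h⟩ => ⟨a, ha, h.symm⟩, rfl, rfl⟩

theorem mem_MCpre_inr_iff {N : PNwT α β} {n : ℕ} {τ : MCTran α β n} (hτ : τ ∈ MCTrans N n)
    (i : Fin n) (x : Option α) :
    Sum.inr (i, x) ∈ MCpre N n τ ↔ ∃ q, τ.2 i = some (x, q) := by
  cases x <;> simp [MCpre, MCFpt, hτ]

theorem mem_MCpost_inr_iff {N : PNwT α β} {n : ℕ} {τ : MCTran α β n} (hτ : τ ∈ MCTrans N n)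
    (i : Fin n) (x : Option α) :
    Sum.inr (i, x) ∈ MCpost N n τ ↔ ∃ q y, x = some q ∧ τ.2 i = some (y, q) := by
  cases x <;> simp [MCpost, MCFtp, hτ]

/-- The `i`-th tracking subnet carries exactly one token in `M`, namely on the place indexed
by `x`, which is either `ι_i` or the copy of a place of `N`. -/
def IsTokenAt (N : PNwT α β) {n : ℕ} (i : Fin n) (M : Set (MCPlace α n)) (x : Option α) : Prop :=
  (∀ p, x = some p → p ∈ N.P) ∧ ∀ y, Sum.inr (i, y) ∈ M ↔ y = x

theorem isTokenAt_MCInit (N : PNwT α β) {n : ℕ} (i : Fin n) :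
    IsTokenAt N i (MCInit N n) none := by
  simp [IsTokenAt, MCInit, eq_comm]

theorem MCfire.exists_isTokenAt {N : PNwT α β} {n : ℕ} {i : Fin n} {A B : Set (MCPlace α n)}
    {τ : MCTran α β n} (h : MCfire N n A τ B) {x : Option α} (hx : IsTokenAt N i A x) :
    ∃ y, IsTokenAt N i B y := by
  obtain ⟨hτ, hpre, -, rfl⟩ := h
  obtain ⟨ht, hc⟩ := (mem_MCTrans_iff N n τ).1 hτ
  rcases hc i with hi | ⟨⟨y, q⟩, hyq, hi⟩
  · refine ⟨x, hx.1, fun z => ?_⟩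
    simp [mem_MCpre_inr_iff hτ, mem_MCpost_inr_iff hτ, hi, hx.2]
  · have hy : y = x := (hx.2 y).1 (hpre ((mem_MCpre_inr_iff hτ i y).2 ⟨q, hi⟩))
    refine ⟨some q, fun p hp => ?_, fun z => ?_⟩
    · obtain rfl := Option.some.inj hp
      exact (N.ftp_mem _ (N.transit_post _ ht _ hyq)).2
    · simp only [Set.mem_union, Set.mem_sdiff, mem_MCpre_inr_iff hτ, mem_MCpost_inr_iff hτ, hi,
        hx.2, Option.some.injEq, Prod.mk.injEq]
      grind

theorem exists_isTokenAt_of_mem_MCreach {N : PNwT α β} {n : ℕ} {M : Set (MCPlace α n)}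
    (hM : M ∈ MCreach N n) (i : Fin n) : ∃ x, IsTokenAt N i M x := by
  induction hM with
  | refl => exact ⟨none, isTokenAt_MCInit N i⟩
  | tail _ hfire ih =>
    obtain ⟨τ, hτ⟩ := hfire
    obtain ⟨x, hx⟩ := ih
    exact hτ.exists_isTokenAt hx

/-- each tracking subnet carries exactly one token: for every marking `M`
reachable in `N^MC` from `In^MC` and every `i`, exactly one place of the set
`{ι_i} ∪ {[p]_i | p ∈ P}` belongs to `M`. -/
theorem mc_one_token_per_subnet (N : PNwT α β) (n : ℕ)
    (M : Set (MCPlace α n)) (hM : M ∈ MCreach N n) (i : Fin n) :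
    ∃! pl : MCPlace α n,
      pl ∈ ({Sum.inr (i, none)} ∪ (fun p : α => Sum.inr (i, some p)) '' ↑N.P :
              Set (MCPlace α n)) ∧ pl ∈ M := by
  obtain ⟨x, hxP, hx⟩ := exists_isTokenAt_of_mem_MCreach hM i
  refine ⟨Sum.inr (i, x), ⟨?_, (hx x).2 rfl⟩, ?_⟩
  · cases x with
    | none => exact Or.inl rfl
    | some p => exact Or.inr ⟨p, hxP p rfl, rfl⟩
  · rintro _ ⟨rfl | ⟨p, -, rfl⟩, hM'⟩ <;> exact congrArg (fun y => Sum.inr (i, y)) ((hx _).1 hM')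
end
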